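/- Let 2 ≤ p < ∞ and κ > 0. There exists C = C(p, κ) such that for all λ > 1 and all 0 < δ < 1 with δ > λ^{−1/2 + 3/p + κ}, the following holds: for every finitely supported a : ℤ³ → ℂ vanishing outside the shell {k ∈ ℤ³ : | |k| − λ | < δ}, one has ‖f‖_{L^p} ≤ C ((λδ)^{1/2 − 1/p} + λ^{1 − 3/p} δ^{1/2}) ‖a‖_{ℓ²}. -/

import Mathlib

open MeasureTheory

noncomputable def trigSum (a : (Fin 3 → ℤ) →₀ ℂ) (x : Fin 3 → ℝ) : ℂ :=
  ∑ k ∈ a.support, a k * Complex.exp (2 * Real.pi * Complex.I * ((∑ i, (k i : ℝ) * x i : ℝ) : ℂ))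

noncomputable def lpNorm (p : ℝ) (a : (Fin 3 → ℤ) →₀ ℂ) : ℝ :=
  (∫ x in (Set.univ.pi fun _ : Fin 3 => Set.Icc (0:ℝ) 1), ‖trigSum a x‖ ^ p) ^ (1 / p)

noncomputable def l2Norm (a : (Fin 3 → ℤ) →₀ ℂ) : ℝ :=
  (∑ k ∈ a.support, ‖a k‖ ^ 2) ^ ((1:ℝ) / 2)

section Yukawa

noncomputable def yukawaRadial (c : ℂ) (r : ℝ) : ℂ := Complex.exp (-c * r) / r

lemma norm_yukawaRadial (c : ℂ) {r : ℝ} (hr : 0 ≤ r) :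
    ‖yukawaRadial c r‖ = Real.exp (-c.re * r) / r := by
  rw [yukawaRadial, norm_div, Complex.norm_exp, Complex.norm_real, Real.norm_of_nonneg hr]
  simp

lemma measurable_yukawaRadial (c : ℂ) : Measurable (yukawaRadial c) := by
  unfold yukawaRadial
  fun_prop

lemma integral_Ioi_yukawaRadial {c : ℂ} (hc : 0 < c.re) (s : ℝ) :
    ∫ r in Set.Ioi (0 : ℝ), r • yukawaRadial c (√(s ^ 2 + r ^ 2)) =
      Complex.exp (-c * |s|) / c := by
  have hc0 : c ≠ 0 := by rintro rfl; simp at hc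
  have hder : ∀ r ∈ Set.Ioi (0 : ℝ),
      HasDerivAt (fun r : ℝ => -(Complex.exp (-c * (√(s ^ 2 + r ^ 2) : ℝ)) / c))
        (r • yukawaRadial c (√(s ^ 2 + r ^ 2))) r := by
    intro r hr
    have hr : 0 < r := hr
    have hpos : 0 < s ^ 2 + r ^ 2 := by positivity
    have h1 : HasDerivAt (fun r : ℝ => √(s ^ 2 + r ^ 2)) (2 * r / (2 * √(s ^ 2 + r ^ 2))) r := by
      have := ((hasDerivAt_pow 2 r).const_add (s ^ 2)).sqrt hpos.ne'
      simpa using this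
    have h2 := (((h1.ofReal_comp).const_mul (-c)).cexp.div_const c).neg
    refine h2.congr_deriv ?_
    have hs : ((√(s ^ 2 + r ^ 2) : ℝ) : ℂ) ≠ 0 := by
      exact_mod_cast (Real.sqrt_pos.2 hpos).ne'
    rw [Complex.real_smul]
    simp only [yukawaRadial]
    push_cast
    field_simp
  have hint : IntegrableOn (fun r : ℝ => r • yukawaRadial c (√(s ^ 2 + r ^ 2)))
      (Set.Ioi 0) := by
    refine Integrable.mono' (integrableOn_exp_mul_Ioi (a := -c.re) (by linarith) 0) ?_ ?_
    · apply Measurable.aestronglyMeasurable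
      have := measurable_yukawaRadial c
      fun_prop
    · refine (ae_restrict_mem measurableSet_Ioi).mono fun r hr => ?_
      have hr : 0 < r := hr
      have hle : r ≤ √(s ^ 2 + r ^ 2) := Real.le_sqrt_of_sq_le (by nlinarith [sq_nonneg s])
      rw [norm_smul, norm_yukawaRadial c (Real.sqrt_nonneg _), Real.norm_of_nonneg hr.le]
      calc r * (Real.exp (-c.re * √(s ^ 2 + r ^ 2)) / √(s ^ 2 + r ^ 2))
          = Real.exp (-c.re * √(s ^ 2 + r ^ 2)) * (r / √(s ^ 2 + r ^ 2)) := by ring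
        _ ≤ Real.exp (-c.re * r) * 1 := by
          have h3 : r / √(s ^ 2 + r ^ 2) ≤ 1 := div_le_one_of_le₀ hle (Real.sqrt_nonneg _)
          have h4 : -c.re * √(s ^ 2 + r ^ 2) ≤ -c.re * r := by nlinarith
          gcongr
        _ = _ := mul_one _
  have hlim : Filter.Tendsto (fun r : ℝ => -(Complex.exp (-c * (√(s ^ 2 + r ^ 2) : ℝ)) / c))
      Filter.atTop (nhds 0) := by
    rw [tendsto_zero_iff_norm_tendsto_zero]
    have h5 : Filter.Tendsto (fun r : ℝ => Real.exp (-(c.re * r)) / ‖c‖) Filter.atTop (nhds 0) := by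
      have := (Real.tendsto_exp_neg_atTop_nhds_zero.comp
        (Filter.tendsto_id.const_mul_atTop hc)).div_const ‖c‖
      simpa using this
    refine squeeze_zero' (Filter.Eventually.of_forall fun _ => norm_nonneg _) ?_ h5
    filter_upwards [Filter.eventually_ge_atTop 0] with r hr
    have hle : r ≤ √(s ^ 2 + r ^ 2) := Real.le_sqrt_of_sq_le (by nlinarith [sq_nonneg s])
    rw [norm_neg, norm_div, Complex.norm_exp]
    have : (-c * ((√(s ^ 2 + r ^ 2) : ℝ) : ℂ)).re = -c.re * √(s ^ 2 + r ^ 2) := by simp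
    rw [this]
    gcongr
    nlinarith
  have hcont : ContinuousWithinAt
      (fun r : ℝ => -(Complex.exp (-c * (√(s ^ 2 + r ^ 2) : ℝ)) / c)) (Set.Ici 0) 0 := by
    apply Continuous.continuousWithinAt
    fun_prop
  rw [integral_Ioi_of_hasDerivAt_of_tendsto hcont hder hint hlim]
  simp [Real.sqrt_sq_eq_abs]

lemma integral_plane_yukawaRadial {c : ℂ} (hc : 0 < c.re) (s : ℝ) :
    ∫ u : EuclideanSpace ℝ (Fin 2), yukawaRadial c (√(s ^ 2 + ‖u‖ ^ 2)) =
      2 * Real.pi / c * Complex.exp (-c * |s|) := by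
  rw [integral_fun_norm_addHaar volume (fun r => yukawaRadial c (√(s ^ 2 + r ^ 2)))]
  simp only [finrank_euclideanSpace, Fintype.card_fin, Nat.add_one_sub_one, pow_one,
    integral_Ioi_yukawaRadial hc]
  have : (volume : Measure (EuclideanSpace ℝ (Fin 2))).real (Metric.ball 0 1) = Real.pi := by
    rw [Measure.real, EuclideanSpace.volume_ball_fin_two]
    simp [Real.pi_pos.le]
  rw [this, Complex.real_smul, nsmul_eq_mul]
  push_cast
  ring

lemma integral_exp_neg_mul_abs {c : ℂ} (hc : 0 < c.re) (q : ℝ) :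
    ∫ s : ℝ, Complex.exp (-c * |s|) * Complex.exp (-(2 * Real.pi * Complex.I * (q * s : ℝ))) =
      2 * c / (c ^ 2 + 4 * Real.pi ^ 2 * q ^ 2) := by
  set a : ℂ := 2 * Real.pi * Complex.I * q with ha
  have hare : a.re = 0 := by simp [ha]
  have h1 : ∀ s ∈ Set.Ioi (0 : ℝ), Complex.exp (-c * |s|) *
      Complex.exp (-(2 * Real.pi * Complex.I * (q * s : ℝ))) = Complex.exp ((-c - a) * s) := by
    intro s hs
    rw [← Complex.exp_add, abs_of_pos hs]
    congr 1
    rw [ha]; push_cast; ring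
  have h2 : ∀ s ∈ Set.Iic (0 : ℝ), Complex.exp (-c * |s|) *
      Complex.exp (-(2 * Real.pi * Complex.I * (q * s : ℝ))) = Complex.exp ((c - a) * s) := by
    intro s hs
    rw [← Complex.exp_add, abs_of_nonpos hs]
    congr 1
    rw [ha]; push_cast; ring
  have hre1 : (-c - a).re < 0 := by simp [hare, hc]
  have hre2 : 0 < (c - a).re := by simp [hare, hc]
  have hi1 : IntegrableOn (fun s : ℝ => Complex.exp (-c * |s|) *
      Complex.exp (-(2 * Real.pi * Complex.I * (q * s : ℝ)))) (Set.Ioi 0) :=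
    (integrableOn_exp_mul_complex_Ioi hre1 0).congr_fun (fun s hs => (h1 s hs).symm)
      measurableSet_Ioi
  have hi2 : IntegrableOn (fun s : ℝ => Complex.exp (-c * |s|) *
      Complex.exp (-(2 * Real.pi * Complex.I * (q * s : ℝ)))) (Set.Iic 0) :=
    (integrableOn_exp_mul_complex_Iic hre2 0).congr_fun (fun s hs => (h2 s hs).symm)
      measurableSet_Iic
  rw [← intervalIntegral.integral_Iic_add_Ioi hi2 hi1, setIntegral_congr_fun measurableSet_Ioi h1,
    setIntegral_congr_fun measurableSet_Iic h2, integral_exp_mul_complex_Ioi hre1,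
    integral_exp_mul_complex_Iic hre2]
  have n1 : c - a ≠ 0 := by intro h; rw [h] at hre2; simp at hre2
  have n2 : -c - a ≠ 0 := by intro h; rw [h] at hre1; simp at hre1
  have n3 : c ^ 2 + 4 * Real.pi ^ 2 * q ^ 2 = -((c - a) * (-c - a)) := by
    rw [ha]; ring_nf; simp
  rw [n3]
  simp only [Complex.ofReal_zero, mul_zero, Complex.exp_zero]
  have n4 : -((c - a) * (-c - a)) ≠ 0 := neg_ne_zero.2 (mul_ne_zero n1 n2)
  field_simp
  ring

lemma exists_isometry_inner_eq (ξ : EuclideanSpace ℝ (Fin 3)) :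
    ∃ U : EuclideanSpace ℝ (Fin 3) ≃ₗᵢ[ℝ] EuclideanSpace ℝ (Fin 3),
      ∀ y, inner ℝ ξ (U y) = ‖ξ‖ * y 0 := by
  by_cases hξ : ξ = 0
  · exact ⟨LinearIsometryEquiv.refl ℝ _, by simp [hξ]⟩
  have hn : ‖ξ‖ ≠ 0 := norm_ne_zero_iff.2 hξ
  obtain ⟨b, hb⟩ := Orthonormal.exists_orthonormalBasis_extension_of_card_eq (𝕜 := ℝ)
    (E := EuclideanSpace ℝ (Fin 3)) (ι := Fin 3) (by simp)
    (v := fun _ => ‖ξ‖⁻¹ • ξ) (s := {0}) (by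
      refine ⟨fun i => ?_, fun i j hij => absurd (Subsingleton.elim i j) hij⟩
      simp [Set.domRestrict, norm_smul, hn])
  refine ⟨b.repr.symm, fun y => ?_⟩
  have h0 : ξ = ‖ξ‖ • b 0 := by
    rw [hb 0 rfl, smul_smul, mul_inv_cancel₀ hn, one_smul]
  conv_lhs => rw [h0]
  rw [inner_smul_left, ← b.repr.inner_map_map]
  simp [b.repr_self, PiLp.inner_apply]

lemma integrable_yukawa_euclidean {c : ℂ} (hc : 0 < c.re) :
    Integrable (fun y : EuclideanSpace ℝ (Fin 3) => yukawaRadial c ‖y‖) := by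
  rw [integrable_fun_norm_addHaar volume (f := yukawaRadial c)]
  simp only [finrank_euclideanSpace, Fintype.card_fin, Nat.add_one_sub_one]
  have h := integrableOn_rpow_mul_exp_neg_mul_rpow (p := 1) (s := 1) (by norm_num)
    one_pos hc
  refine Integrable.mono' h ?_ ?_
  · apply Measurable.aestronglyMeasurable
    have := measurable_yukawaRadial c
    fun_prop
  · refine (ae_restrict_mem measurableSet_Ioi).mono fun r hr => ?_
    have hr : 0 < r := hr
    rw [norm_smul, norm_yukawaRadial c hr.le, Real.norm_of_nonneg (by positivity)]
    apply le_of_eq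
    simp only [Real.rpow_one]
    field_simp

noncomputable def euclid (z : Fin 3 → ℝ) : ℝ := √(∑ i, z i ^ 2)

lemma euclid_eq_norm (z : Fin 3 → ℝ) : euclid z = ‖WithLp.toLp 2 z‖ := by
  simp [euclid, EuclideanSpace.norm_eq]

lemma integrable_yukawa {c : ℂ} (hc : 0 < c.re) :
    Integrable (fun z : Fin 3 → ℝ => yukawaRadial c (euclid z)) := by
  simp_rw [euclid_eq_norm]
  exact (PiLp.volume_preserving_toLp (Fin 3)).integrable_comp_of_integrable
    (integrable_yukawa_euclidean hc)

lemma integrable_yukawa_mul_exp {c : ℂ} (hc : 0 < c.re) (k : Fin 3 → ℝ) :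
    Integrable (fun z : Fin 3 → ℝ => yukawaRadial c (euclid z) *
      Complex.exp (-(2 * Real.pi * Complex.I * (∑ i, k i * z i : ℝ)))) := by
  refine (integrable_yukawa hc).mul_of_top_left ?_
  refine memLp_top_of_bound (by apply Continuous.aestronglyMeasurable; fun_prop) 1 (Filter.Eventually.of_forall fun z => ?_)
  rw [Complex.norm_exp]
  simp

lemma integral_yukawa_mul_exp {c : ℂ} (hc : 0 < c.re) (k : Fin 3 → ℝ) :
    ∫ z : Fin 3 → ℝ, yukawaRadial c (euclid z) *
      Complex.exp (-(2 * Real.pi * Complex.I * (∑ i, k i * z i : ℝ))) =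
      4 * Real.pi / (c ^ 2 + 4 * Real.pi ^ 2 * (∑ i, k i ^ 2 : ℝ)) := by
  have hc0 : c ≠ 0 := by rintro rfl; simp at hc
  set ξ : EuclideanSpace ℝ (Fin 3) := WithLp.toLp 2 k with hξ
  obtain ⟨U, hU⟩ := exists_isometry_inner_eq ξ
  have e1 : ∫ z : Fin 3 → ℝ, yukawaRadial c (euclid z) *
      Complex.exp (-(2 * Real.pi * Complex.I * (∑ i, k i * z i : ℝ))) =
      ∫ y : EuclideanSpace ℝ (Fin 3), yukawaRadial c ‖y‖ *
      Complex.exp (-(2 * Real.pi * Complex.I * (inner ℝ ξ y : ℝ))) := by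
    rw [← (PiLp.volume_preserving_toLp (Fin 3)).integral_comp
      (MeasurableEquiv.toLp 2 _).measurableEmbedding]
    refine integral_congr_ae (Filter.Eventually.of_forall fun z => ?_)
    simp [euclid_eq_norm, hξ, PiLp.inner_apply, mul_comm]
  have e2 : ∫ y : EuclideanSpace ℝ (Fin 3), yukawaRadial c ‖y‖ *
      Complex.exp (-(2 * Real.pi * Complex.I * (inner ℝ ξ y : ℝ))) =
      ∫ y : EuclideanSpace ℝ (Fin 3), yukawaRadial c ‖y‖ *
      Complex.exp (-(2 * Real.pi * Complex.I * (‖ξ‖ * y 0 : ℝ))) := by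
    rw [← U.measurePreserving.integral_comp U.toHomeomorph.measurableEmbedding]
    simp only [hU, LinearIsometryEquiv.norm_map]
  have e3 : ∫ y : EuclideanSpace ℝ (Fin 3), yukawaRadial c ‖y‖ *
      Complex.exp (-(2 * Real.pi * Complex.I * (‖ξ‖ * y 0 : ℝ))) =
      ∫ z : Fin 3 → ℝ, yukawaRadial c (euclid z) *
      Complex.exp (-(2 * Real.pi * Complex.I * (‖ξ‖ * z 0 : ℝ))) := by
    rw [← (PiLp.volume_preserving_toLp (Fin 3)).integral_comp
      (MeasurableEquiv.toLp 2 _).measurableEmbedding]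
    simp [euclid_eq_norm]
  have mp := volume_preserving_piFinSuccAbove (fun _ : Fin 3 => ℝ) 0
  have hcomp : ∀ z : Fin 3 → ℝ, yukawaRadial c (euclid z) *
      Complex.exp (-(2 * Real.pi * Complex.I * (‖ξ‖ * z 0 : ℝ))) =
      (fun w : ℝ × (Fin 2 → ℝ) => yukawaRadial c (√(w.1 ^ 2 + ∑ i, w.2 i ^ 2)) *
      Complex.exp (-(2 * Real.pi * Complex.I * (‖ξ‖ * w.1 : ℝ))))
        (MeasurableEquiv.piFinSuccAbove (fun _ : Fin 3 => ℝ) 0 z) := by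
    intro z
    simp [euclid, Fin.sum_univ_succ, MeasurableEquiv.piFinSuccAbove, Fin.tail]
  have hinner : ∀ s : ℝ, ∫ u : Fin 2 → ℝ, yukawaRadial c (√(s ^ 2 + ∑ i, u i ^ 2)) =
      2 * Real.pi / c * Complex.exp (-c * |s|) := by
    intro s
    rw [← integral_plane_yukawaRadial hc s, ← (PiLp.volume_preserving_toLp (Fin 2)).integral_comp
      (MeasurableEquiv.toLp 2 _).measurableEmbedding]
    simp [EuclideanSpace.norm_sq_eq]
  have hint := integrable_yukawa_mul_exp hc (Pi.single 0 ‖ξ‖)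
  have hint' : Integrable (fun z : Fin 3 → ℝ => yukawaRadial c (euclid z) *
      Complex.exp (-(2 * Real.pi * Complex.I * (‖ξ‖ * z 0 : ℝ)))) := by
    refine hint.congr (Filter.Eventually.of_forall fun z => ?_)
    simp [Fin.sum_univ_succ]
  rw [funext hcomp] at hint'
  rw [e1, e2, e3, funext hcomp]
  refine (mp.integral_comp
    (MeasurableEquiv.piFinSuccAbove (fun _ : Fin 3 => ℝ) 0).measurableEmbedding
    (fun w : ℝ × (Fin 2 → ℝ) => yukawaRadial c (√(w.1 ^ 2 + ∑ i, w.2 i ^ 2)) *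
      Complex.exp (-(2 * Real.pi * Complex.I * (‖ξ‖ * w.1 : ℝ))))).trans ?_
  have hint2 := (mp.integrable_comp_emb
    (MeasurableEquiv.piFinSuccAbove (fun _ : Fin 3 => ℝ) 0).measurableEmbedding
    (g := fun w : ℝ × (Fin 2 → ℝ) => yukawaRadial c (√(w.1 ^ 2 + ∑ i, w.2 i ^ 2)) *
      Complex.exp (-(2 * Real.pi * Complex.I * (‖ξ‖ * w.1 : ℝ))))).1 hint'
  refine (integral_prod _ hint2).trans ?_
  simp only [integral_mul_const]
  have hn2 : ‖ξ‖ ^ 2 = ∑ i, k i ^ 2 := by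
    rw [EuclideanSpace.norm_sq_eq]
    simp [hξ]
  calc _ = ∫ s : ℝ, 2 * Real.pi / c * (Complex.exp (-c * |s|) *
        Complex.exp (-(2 * Real.pi * Complex.I * (‖ξ‖ * s : ℝ)))) := by
        refine integral_congr_ae (Filter.Eventually.of_forall fun s => ?_)
        simp only [← mul_assoc]
        rw [← hinner s]
    _ = _ := by
        rw [integral_const_mul, integral_exp_neg_mul_abs hc, ← hn2]
        push_cast
        field_simp
        norm_num

end Yukawa

section TorusKernel

noncomputable local instance : MeasureSpace UnitAddCircle := ⟨AddCircle.haarAddCircle⟩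

local instance : Measure.IsAddHaarMeasure (volume : Measure UnitAddCircle) :=
  inferInstanceAs (Measure.IsAddHaarMeasure AddCircle.haarAddCircle)

local instance : IsProbabilityMeasure (volume : Measure UnitAddCircle) :=
  inferInstanceAs (IsProbabilityMeasure AddCircle.haarAddCircle)

def toTorus (z : Fin 3 → ℝ) : UnitAddTorus (Fin 3) := fun i => (z i : UnitAddCircle)

lemma continuous_toTorus : Continuous toTorus :=
  continuous_pi fun i => (AddCircle.continuous_mk' 1).comp (continuous_apply i)

def latticeCube (n : Fin 3 → ℤ) : Set (Fin 3 → ℝ) :=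
  {z | ∀ i, z i ∈ Set.Ioc ((n i : ℝ) - 1 / 2) ((n i : ℝ) - 1 / 2 + 1)}

lemma measurableSet_latticeCube (n : Fin 3 → ℤ) : MeasurableSet (latticeCube n) :=
  MeasurableSet.univ_pi' fun _ => measurableSet_Ioc

lemma iUnion_latticeCube : ⋃ n, latticeCube n = Set.univ := by
  refine Set.eq_univ_of_forall fun z => Set.mem_iUnion.2 ⟨fun i => ⌈z i - 1 / 2⌉, fun i => ?_⟩
  have h1 := Int.le_ceil (z i - 1 / 2)
  have h2 := Int.ceil_lt_add_one (z i - 1 / 2)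
  constructor <;> linarith

lemma lintegral_latticeCube_comp_toTorus (ρ : UnitAddTorus (Fin 3) → ENNReal) (n : Fin 3 → ℤ) :
    ∫⁻ z in latticeCube n, ρ (toTorus z) = ∫⁻ y, ρ y :=
  (UnitAddTorus.lintegral_preimage ρ fun i => (n i : ℝ) - 1 / 2).symm

lemma norm_le_euclid (z : Fin 3 → ℝ) : ‖z‖ ≤ euclid z := by
  refine (pi_norm_le_iff_of_nonneg (Real.sqrt_nonneg _)).2 fun i => ?_
  rw [Real.norm_eq_abs, ← Real.sqrt_sq_eq_abs]
  exact Real.sqrt_le_sqrt (Finset.single_le_sum (f := fun i => z i ^ 2)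
    (fun j _ => sq_nonneg _) (Finset.mem_univ i))

lemma half_norm_le_of_mem_latticeCube {n : Fin 3 → ℤ} {z : Fin 3 → ℝ} (hz : z ∈ latticeCube n) :
    ‖n‖ / 2 ≤ ‖z‖ := by
  suffices ‖n‖ ≤ 2 * ‖z‖ by linarith
  refine (pi_norm_le_iff_of_nonneg (by positivity)).2 fun i => ?_
  have hzi := norm_le_pi_norm z i
  rw [Real.norm_eq_abs] at hzi
  obtain ⟨h1, h2⟩ := hz i
  rw [Int.norm_eq_abs]
  rcases lt_trichotomy (n i) 0 with h | h | h
  · have h' : (n i : ℝ) ≤ -1 := by exact_mod_cast (by omega : n i ≤ -1)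
    rw [abs_of_neg (by linarith)]
    have := neg_abs_le (z i)
    linarith
  · rw [h]; simp
  · have h' : (1 : ℝ) ≤ n i := by exact_mod_cast h
    rw [abs_of_pos (by linarith)]
    have := le_abs_self (z i)
    linarith

lemma Real.rpow_le_const_mul_exp {t u : ℝ} (ht : 0 < t) (hu : 0 ≤ u) :
    u ^ t ≤ t ^ t * Real.exp u := by
  have h1 : u / t ≤ Real.exp (u / t) := by linarith [Real.add_one_le_exp (u / t)]
  have h2 : (u / t) ^ t ≤ Real.exp (u / t) ^ t :=
    Real.rpow_le_rpow (by positivity) h1 ht.le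
  rw [← Real.exp_mul, div_mul_cancel₀ _ ht.ne', Real.div_rpow hu ht.le,
    div_le_iff₀ (by positivity)] at h2
  linarith

lemma summable_int_norm_rpow {t : ℝ} (ht : 3 < t) :
    Summable fun n : Fin 3 → ℤ => ‖n‖ ^ (-t) := by
  set b := Pi.basisFun ℝ (Fin 3)
  have hs := ZLattice.summable_norm_rpow (Submodule.span ℤ (Set.range b)) (-t) (by
    rw [ZLattice.rank ℝ]
    simp [ht])
  let f : (Fin 3 → ℤ) → Submodule.span ℤ (Set.range b) := fun n =>
    ⟨fun i => (n i : ℝ), by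
      rw [Module.Basis.mem_span_iff_repr_mem]
      intro i
      simp [b]⟩
  have hf : Function.Injective f := by
    intro n n' h
    have := congrArg Subtype.val h
    funext i
    have hi : (n i : ℝ) = n' i := congrFun this i
    exact_mod_cast hi
  refine (hs.comp_injective hf).congr fun n => ?_
  have : ‖(fun i => (n i : ℝ))‖ = ‖n‖ := by
    simp [Pi.norm_def, NNReal.coe_inj]
    rfl
  change ‖(fun i => (n i : ℝ))‖ ^ (-t) = _
  rw [this]

lemma exp_neg_div_le {δ s e N : ℝ} (hδ : 0 < δ) (hs : 0 < 1 + s) (hN : 0 < N) (he : N / 2 ≤ e) :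
    Real.exp (-(2 * Real.pi * δ) * e) / e ≤
      (1 + s) ^ (1 + s) * 2 ^ (2 + s) * δ ^ (-(1 + s)) * N ^ (-(2 + s)) := by
  have hepos : 0 < e := by linarith
  have h1 : Real.exp (-(2 * Real.pi * δ) * e) ≤ Real.exp (-(δ * (N / 2))) := by
    apply Real.exp_le_exp.2
    have : δ * (N / 2) ≤ 1 * (δ * e) := by rw [one_mul]; gcongr
    have h3 : 1 * (δ * e) ≤ (2 * Real.pi) * (δ * e) := by
      gcongr
      linarith [Real.pi_gt_three]
    linarith
  have h2 := Real.rpow_le_const_mul_exp hs (u := δ * (N / 2)) (by positivity)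
  have h3 : Real.exp (-(δ * (N / 2))) ≤ (1 + s) ^ (1 + s) * (δ * (N / 2)) ^ (-(1 + s)) := by
    rw [Real.exp_neg, Real.rpow_neg (by positivity), inv_le_iff_one_le_mul₀ (by positivity),
      mul_right_comm, ← div_eq_mul_inv, one_le_div (by positivity)]
    exact h2
  calc Real.exp (-(2 * Real.pi * δ) * e) / e
      ≤ ((1 + s) ^ (1 + s) * (δ * (N / 2)) ^ (-(1 + s))) / (N / 2) := by
        gcongr
        exact h1.trans h3
    _ = (1 + s) ^ (1 + s) * δ ^ (-(1 + s)) * ((N / 2) ^ (-(1 + s)) * (N / 2) ^ (-1 : ℝ)) := by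
        rw [Real.mul_rpow hδ.le (by positivity), Real.rpow_neg_one]
        ring
    _ = _ := by
        rw [← Real.rpow_add (by positivity), Real.div_rpow hN.le (by norm_num),
          show -(1 + s) + -1 = -(2 + s) by ring, Real.rpow_neg (x := 2) (by norm_num)]
        field_simp

lemma lintegral_ball_inv_norm {m r : ℝ} (hm : 0 ≤ m) (hr : 0 ≤ r) :
    ∫⁻ z : Fin 3 → ℝ, ENNReal.ofReal ((Set.Iic r).indicator (fun y => m / y) ‖z‖) =
      ENNReal.ofReal (12 * m * r ^ 2) := by
  have hfun : Set.EqOn (fun y : ℝ => y ^ 2 • (Set.Iic r).indicator (fun y => m / y) y)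
      ((Set.Iic r).indicator fun y => m * y) (Set.Ioi 0) := by
    intro y hy
    have hy : 0 < y := hy
    by_cases h : y ≤ r
    · simp [Set.indicator, h]; field_simp
    · simp [Set.indicator, h]
  have hI : IntegrableOn ((Set.Iic r).indicator fun y => m * y) (Set.Ioi 0) := by
    rw [IntegrableOn, integrable_indicator_iff measurableSet_Iic, IntegrableOn,
      Measure.restrict_restrict measurableSet_Iic, Set.inter_comm, Set.Ioi_inter_Iic]
    exact (Continuous.integrableOn_Icc (by fun_prop)).mono_set Set.Ioc_subset_Icc_self
  have hint : Integrable fun z : Fin 3 → ℝ => (Set.Iic r).indicator (fun y => m / y) ‖z‖ := by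
    rw [integrable_fun_norm_addHaar volume (f := (Set.Iic r).indicator fun y => m / y)]
    simp only [Module.finrank_fintype_fun_eq_card, Fintype.card_fin, Nat.add_one_sub_one]
    exact hI.congr_fun hfun.symm measurableSet_Ioi
  rw [← ofReal_integral_eq_lintegral_ofReal hint]
  · congr 1
    rw [integral_fun_norm_addHaar volume ((Set.Iic r).indicator fun y => m / y)]
    simp only [Module.finrank_fintype_fun_eq_card, Fintype.card_fin, Nat.add_one_sub_one]
    rw [setIntegral_congr_fun measurableSet_Ioi hfun, setIntegral_indicator measurableSet_Iic,
      Set.Ioi_inter_Iic, ← intervalIntegral.integral_of_le hr]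
    have hv : (volume : Measure (Fin 3 → ℝ)).real (Metric.ball 0 1) = 8 := by
      rw [Measure.real, Real.volume_pi_ball _ one_pos]
      norm_num
    rw [hv, intervalIntegral.integral_const_mul, integral_id]
    simp
    ring
  · refine Filter.Eventually.of_forall fun z => ?_
    simp only [Pi.zero_apply, Set.indicator_apply]
    split_ifs <;> positivity

/-- The integral of an exponentially damped Newtonian kernel against a periodic weight, split into
the central unit cube and its lattice translates. -/
lemma exists_lintegral_kernel_le {s : ℝ} (hs : 1 < s) :
    ∃ C : ℝ, 0 < C ∧ ∀ (δ m : ℝ) (ρ : UnitAddTorus (Fin 3) → ENNReal), 0 < δ → 0 < m →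
      Measurable ρ → (∀ y, ρ y ≤ ENNReal.ofReal m) → ∫⁻ y, ρ y ≤ ENNReal.ofReal (m ^ 2) →
      ∫⁻ z, ENNReal.ofReal (Real.exp (-(2 * Real.pi * δ) * euclid z) / euclid z) *
        ρ (toTorus z) ≤
      ENNReal.ofReal (C * (m ^ (5 / 3 : ℝ) + m ^ 2 * δ ^ (-(1 + s)))) := by
  have hsum := summable_int_norm_rpow (t := 2 + s) (by linarith)
  set S := ∑' n : Fin 3 → ℤ, ‖n‖ ^ (-(2 + s)) with hS
  have hS0 : 0 ≤ S := tsum_nonneg fun n => by positivity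
  set K := (1 + s) ^ (1 + s) * 2 ^ (2 + s) with hK
  have hK0 : 0 < K := by positivity
  refine ⟨13 + K * S, by positivity, fun δ m ρ hδ hm hρ hρm hρi => ?_⟩
  set φ : (Fin 3 → ℝ) → ENNReal := fun z =>
    ENNReal.ofReal (Real.exp (-(2 * Real.pi * δ) * euclid z) / euclid z)
  set r := m ^ (1 / 3 : ℝ) with hr
  have hr0 : 0 < r := by positivity
  have hr3 : r ^ 3 = m := by
    rw [hr, ← Real.rpow_natCast, ← Real.rpow_mul hm.le]; norm_num
  have hm53 : m ^ (5 / 3 : ℝ) = r ^ 5 := by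
    rw [hr, ← Real.rpow_natCast, ← Real.rpow_mul hm.le]; norm_num
  have hnear : ∫⁻ z in latticeCube 0, φ z * ρ (toTorus z) ≤ ENNReal.ofReal (13 * r ^ 5) := by
    have hpt : ∀ z, φ z * ρ (toTorus z) ≤
        ENNReal.ofReal ((Set.Iic r).indicator (fun y => m / y) ‖z‖) +
          ENNReal.ofReal (1 / r) * ρ (toTorus z) := by
      intro z
      rcases eq_or_ne z 0 with rfl | hz
      · simp [φ, euclid]
      have hz0 : 0 < ‖z‖ := norm_pos_iff.2 hz
      have he := norm_le_euclid z
      have h1 : Real.exp (-(2 * Real.pi * δ) * euclid z) / euclid z ≤ 1 / ‖z‖ := by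
        have : 0 ≤ 2 * Real.pi * δ * euclid z := by
          have := Real.pi_pos
          have : 0 ≤ euclid z := Real.sqrt_nonneg _
          positivity
        gcongr
        exact Real.exp_le_one_iff.2 (by linarith)
      by_cases hzr : ‖z‖ ≤ r
      · refine le_add_right ?_
        rw [Set.indicator_of_mem (by exact hzr)]
        calc φ z * ρ (toTorus z) ≤ ENNReal.ofReal (1 / ‖z‖) * ENNReal.ofReal m := by
              exact mul_le_mul' (ENNReal.ofReal_le_ofReal h1) (hρm _)
          _ = _ := by
              rw [← ENNReal.ofReal_mul (by positivity)]
              congr 1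
              ring
      · refine le_add_left ?_
        refine mul_le_mul' (ENNReal.ofReal_le_ofReal (h1.trans ?_)) le_rfl
        have := (not_le.1 hzr).le
        gcongr
    calc ∫⁻ z in latticeCube 0, φ z * ρ (toTorus z)
        ≤ ∫⁻ z in latticeCube 0, (ENNReal.ofReal ((Set.Iic r).indicator (fun y => m / y) ‖z‖) +
          ENNReal.ofReal (1 / r) * ρ (toTorus z)) := lintegral_mono hpt
      _ = (∫⁻ z in latticeCube 0, ENNReal.ofReal ((Set.Iic r).indicator (fun y => m / y) ‖z‖)) +
          ENNReal.ofReal (1 / r) * ∫⁻ z in latticeCube 0, ρ (toTorus z) := by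
          have hmeas : Measurable fun z => ρ (toTorus z) := hρ.comp continuous_toTorus.measurable
          rw [lintegral_add_right _ (hmeas.const_mul _), lintegral_const_mul _ hmeas]
      _ ≤ ENNReal.ofReal (12 * m * r ^ 2) + ENNReal.ofReal (1 / r) * ENNReal.ofReal (m ^ 2) := by
          rw [lintegral_latticeCube_comp_toTorus, ← lintegral_ball_inv_norm hm.le hr0.le]
          exact add_le_add (lintegral_mono' Measure.restrict_le_self le_rfl)
            (mul_le_mul' le_rfl hρi)
      _ = ENNReal.ofReal (13 * r ^ 5) := by
          rw [← ENNReal.ofReal_mul (by positivity), ← ENNReal.ofReal_add (by positivity)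
            (by positivity), ← hr3]
          congr 1
          field_simp
          ring
  have hfar : ∀ n : Fin 3 → ℤ, n ≠ 0 → ∫⁻ z in latticeCube n, φ z * ρ (toTorus z) ≤
      ENNReal.ofReal (K * δ ^ (-(1 + s)) * m ^ 2 * ‖n‖ ^ (-(2 + s))) := by
    intro n hn
    have hn0 : 0 < ‖n‖ := norm_pos_iff.2 hn
    calc ∫⁻ z in latticeCube n, φ z * ρ (toTorus z)
        ≤ ∫⁻ z in latticeCube n, ENNReal.ofReal (K * δ ^ (-(1 + s)) * ‖n‖ ^ (-(2 + s))) *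
          ρ (toTorus z) := by
          refine setLIntegral_mono' (measurableSet_latticeCube n) fun z hz => ?_
          exact mul_le_mul' (ENNReal.ofReal_le_ofReal (exp_neg_div_le hδ (by linarith) hn0
            ((half_norm_le_of_mem_latticeCube hz).trans (norm_le_euclid z)))) le_rfl
      _ = ENNReal.ofReal (K * δ ^ (-(1 + s)) * ‖n‖ ^ (-(2 + s))) * ∫⁻ y, ρ y := by
          have hmeas : Measurable fun z => ρ (toTorus z) := hρ.comp continuous_toTorus.measurable
          rw [lintegral_const_mul _ hmeas, lintegral_latticeCube_comp_toTorus]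
      _ ≤ ENNReal.ofReal (K * δ ^ (-(1 + s)) * ‖n‖ ^ (-(2 + s))) * ENNReal.ofReal (m ^ 2) := by
          gcongr
      _ = _ := by
          rw [← ENNReal.ofReal_mul (by positivity)]
          congr 1
          ring
  calc ∫⁻ z, φ z * ρ (toTorus z)
      = ∫⁻ z in ⋃ n, latticeCube n, φ z * ρ (toTorus z) := by
        rw [iUnion_latticeCube, Measure.restrict_univ]
    _ ≤ ∑' n, ∫⁻ z in latticeCube n, φ z * ρ (toTorus z) := lintegral_iUnion_le _ _
    _ ≤ ∑' n : Fin 3 → ℤ, ((if n = 0 then ENNReal.ofReal (13 * r ^ 5) else 0) +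
          ENNReal.ofReal (K * δ ^ (-(1 + s)) * m ^ 2 * ‖n‖ ^ (-(2 + s)))) := by
        refine ENNReal.tsum_le_tsum fun n => ?_
        by_cases hn : n = 0
        · subst hn
          simpa using le_add_right hnear
        · simpa [hn] using hfar n hn
    _ = ENNReal.ofReal (13 * r ^ 5) +
          ENNReal.ofReal (K * δ ^ (-(1 + s)) * m ^ 2 * S) := by
        rw [ENNReal.tsum_add, tsum_ite_eq, ← ENNReal.ofReal_tsum_of_nonneg
          (fun n => by positivity) (hsum.mul_left _), tsum_mul_left]
    _ ≤ _ := by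
        rw [← ENNReal.ofReal_add (by positivity) (by positivity), hm53]
        apply ENNReal.ofReal_le_ofReal
        have : 0 ≤ K * S * r ^ 5 := by positivity
        have : 0 ≤ 13 * (m ^ 2 * δ ^ (-(1 + s))) := by positivity
        linarith

lemma mFourier_toTorus (k : Fin 3 → ℤ) (z : Fin 3 → ℝ) :
    UnitAddTorus.mFourier k (toTorus z) =
      Complex.exp (2 * Real.pi * Complex.I * ((∑ i, (k i : ℝ) * z i : ℝ) : ℂ)) := by
  simp only [UnitAddTorus.mFourier, toTorus, ContinuousMap.coe_mk, fourier_coe_apply]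
  rw [← Complex.exp_sum]
  congr 1
  push_cast
  rw [Finset.mul_sum]
  exact Finset.sum_congr rfl fun i _ => by ring

lemma norm_mFourier_apply (k : Fin 3 → ℤ) (y : UnitAddTorus (Fin 3)) :
    ‖UnitAddTorus.mFourier k y‖ = 1 := by
  rw [UnitAddTorus.mFourier, ContinuousMap.coe_mk, norm_prod]
  exact Finset.prod_eq_one fun i _ => Circle.norm_coe _

lemma mFourier_apply_add (k : Fin 3 → ℤ) (x y : UnitAddTorus (Fin 3)) :
    UnitAddTorus.mFourier k (x + y) = UnitAddTorus.mFourier k x * UnitAddTorus.mFourier k y := by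
  simp [UnitAddTorus.mFourier, fourier_apply, AddCircle.toCircle_add, Finset.prod_mul_distrib]

lemma mFourierCoeff_translate (g : UnitAddTorus (Fin 3) → ℂ) (y : UnitAddTorus (Fin 3))
    (k : Fin 3 → ℤ) :
    UnitAddTorus.mFourierCoeff (fun x => g (x + y)) k =
      UnitAddTorus.mFourierCoeff g k * UnitAddTorus.mFourier k y := by
  have h : ∀ x, UnitAddTorus.mFourier (-k) x • g (x + y) =
      (UnitAddTorus.mFourier (-k) (x + y) • g (x + y)) * UnitAddTorus.mFourier k y := by
    intro x
    have h1 : UnitAddTorus.mFourier (-k) y * UnitAddTorus.mFourier k y = 1 := by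
      rw [← UnitAddTorus.mFourier_add, neg_add_cancel, UnitAddTorus.mFourier_zero]
      rfl
    rw [mFourier_apply_add, smul_eq_mul, smul_eq_mul]
    linear_combination (-UnitAddTorus.mFourier (-k) x * g (x + y)) * h1
  simp only [UnitAddTorus.mFourierCoeff]
  simp_rw [h]
  rw [integral_mul_const, integral_add_right_eq_self
    (fun x => UnitAddTorus.mFourier (-k) x • g x) y]

lemma memLp_two_of_norm_le_one {g : UnitAddTorus (Fin 3) → ℂ} (hg : Measurable g)
    (hg1 : ∀ x, ‖g x‖ ≤ 1) : MemLp g 2 :=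
  MemLp.of_bound hg.aestronglyMeasurable 1 (Filter.Eventually.of_forall hg1)

lemma mFourierCoeff_congr {f g : UnitAddTorus (Fin 3) → ℂ} (h : f =ᵐ[volume] g)
    (k : Fin 3 → ℤ) : UnitAddTorus.mFourierCoeff f k = UnitAddTorus.mFourierCoeff g k :=
  integral_congr_ae (h.mono fun x hx => by simp only [hx])

open ComplexConjugate in
lemma hasSum_autocorrelation {g : UnitAddTorus (Fin 3) → ℂ} (hg : Measurable g)
    (hg1 : ∀ x, ‖g x‖ ≤ 1) (y : UnitAddTorus (Fin 3)) :
    HasSum (fun k => ((‖UnitAddTorus.mFourierCoeff g k‖ ^ 2 : ℝ) : ℂ) * UnitAddTorus.mFourier k y)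
      (∫ x, conj (g x) * g (x + y)) := by
  have h1 := memLp_two_of_norm_le_one hg hg1
  have h2 := memLp_two_of_norm_le_one (g := fun x => g (x + y)) (by fun_prop)
    fun x => hg1 _
  have h := UnitAddTorus.hasSum_prod_mFourierCoeff h1.toLp h2.toLp
  simp_rw [mFourierCoeff_congr h1.coeFn_toLp, mFourierCoeff_congr h2.coeFn_toLp,
    mFourierCoeff_translate] at h
  convert h using 1
  · funext k
    rw [← mul_assoc, ← Complex.normSq_eq_conj_mul_self, Complex.normSq_eq_norm_sq]
  · refine integral_congr_ae ?_
    filter_upwards [h1.coeFn_toLp, h2.coeFn_toLp] with x hx hx'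
    rw [hx, hx']

lemma hasSum_sq_norm_mFourierCoeff {g : UnitAddTorus (Fin 3) → ℂ} (hg : Measurable g)
    (hg1 : ∀ x, ‖g x‖ ≤ 1) :
    HasSum (fun k => ‖UnitAddTorus.mFourierCoeff g k‖ ^ 2) (∫ x, ‖g x‖ ^ 2) := by
  have h1 := memLp_two_of_norm_le_one hg hg1
  have h := UnitAddTorus.hasSum_sq_mFourierCoeff h1.toLp
  simp_rw [mFourierCoeff_congr h1.coeFn_toLp] at h
  convert h using 1
  refine integral_congr_ae ?_
  filter_upwards [h1.coeFn_toLp] with x hx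
  rw [hx]

open ComplexConjugate in
lemma hasSum_yukawa_mul_autocorrelation {c : ℂ} (hc : 0 < c.re) {g : UnitAddTorus (Fin 3) → ℂ}
    (hg : Measurable g) (hg1 : ∀ x, ‖g x‖ ≤ 1) :
    HasSum (fun k : Fin 3 → ℤ => ((‖UnitAddTorus.mFourierCoeff g k‖ ^ 2 : ℝ) : ℂ) *
        (4 * Real.pi / (c ^ 2 + 4 * Real.pi ^ 2 * ((∑ i, (k i : ℝ) ^ 2 : ℝ) : ℂ))))
      (∫ z, yukawaRadial c (euclid z) * ∫ x, conj (g x) * g (x + toTorus z)) := by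
  set F : (Fin 3 → ℤ) → (Fin 3 → ℝ) → ℂ := fun k z =>
    ((‖UnitAddTorus.mFourierCoeff g k‖ ^ 2 : ℝ) : ℂ) *
      (yukawaRadial c (euclid z) *
        Complex.exp (-(2 * Real.pi * Complex.I * ((∑ i, (fun j => -(k j : ℝ)) i * z i : ℝ) : ℂ))))
    with hF
  have hexp : ∀ k z, Complex.exp (-(2 * Real.pi * Complex.I *
      ((∑ i, (fun j => -(k j : ℝ)) i * z i : ℝ) : ℂ))) = UnitAddTorus.mFourier k (toTorus z) := by
    intro k z
    rw [mFourier_toTorus]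
    congr 1
    simp [Finset.sum_neg_distrib]
  have hFi : ∀ k, Integrable (F k) := fun k => (integrable_yukawa_mul_exp hc _).const_mul _
  have hFn : ∀ k z, ‖F k z‖ =
      ‖UnitAddTorus.mFourierCoeff g k‖ ^ 2 * ‖yukawaRadial c (euclid z)‖ := by
    intro k z
    simp only [hF, norm_mul, hexp, norm_mFourier_apply, mul_one, Complex.norm_real]
    simp
  have hsum : Summable fun k => ∫ z, ‖F k z‖ := by
    simp_rw [hFn, integral_const_mul]
    exact (hasSum_sq_norm_mFourierCoeff hg hg1).summable.mul_right _
  have h := hasSum_integral_of_summable_integral_norm hFi hsum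
  have hL : ∀ k, ∫ z, F k z = ((‖UnitAddTorus.mFourierCoeff g k‖ ^ 2 : ℝ) : ℂ) *
        (4 * Real.pi / (c ^ 2 + 4 * Real.pi ^ 2 * ((∑ i, (k i : ℝ) ^ 2 : ℝ) : ℂ))) := by
    intro k
    simp only [hF]
    rw [integral_const_mul, integral_yukawa_mul_exp hc]
    simp
  simp_rw [hL] at h
  suffices hR : (fun z => yukawaRadial c (euclid z) * ∫ x, conj (g x) * g (x + toTorus z)) =
      fun z => ∑' k, F k z by
    rw [hR]
    exact h
  funext z
  have hs := ((hasSum_autocorrelation hg hg1 (toTorus z)).mul_left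
    (yukawaRadial c (euclid z))).tsum_eq
  rw [← hs]
  refine tsum_congr fun k => ?_
  simp only [hF, hexp]
  ring

lemma im_yukawa_symbol {lam δ q : ℝ} (hl : 0 < lam) (hδ : 0 < δ) :
    ((4 * Real.pi / ((2 * Real.pi * (δ - lam * Complex.I)) ^ 2 + 4 * Real.pi ^ 2 * (q : ℂ)) :
      ℂ)).im = 2 * lam * δ / (Real.pi * ((q + δ ^ 2 - lam ^ 2) ^ 2 + (2 * lam * δ) ^ 2)) := by
  have hpi := Real.pi_pos
  have hD : 0 < (q + δ ^ 2 - lam ^ 2) ^ 2 + (2 * lam * δ) ^ 2 := by positivity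
  have h1 : (2 * Real.pi * (δ - lam * Complex.I) : ℂ) ^ 2 + 4 * Real.pi ^ 2 * (q : ℂ) =
      4 * Real.pi ^ 2 * (((q + δ ^ 2 - lam ^ 2 : ℝ) : ℂ) - (2 * lam * δ : ℝ) * Complex.I) := by
    push_cast
    linear_combination (4 * Real.pi ^ 2 * lam ^ 2 : ℂ) * Complex.I_sq
  have h2 : (((q + δ ^ 2 - lam ^ 2 : ℝ) : ℂ) - (2 * lam * δ : ℝ) * Complex.I) *
      (((q + δ ^ 2 - lam ^ 2 : ℝ) : ℂ) + (2 * lam * δ : ℝ) * Complex.I) =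
      (((q + δ ^ 2 - lam ^ 2) ^ 2 + (2 * lam * δ) ^ 2 : ℝ) : ℂ) := by
    push_cast
    linear_combination (-(2 * lam * δ) ^ 2 : ℂ) * Complex.I_sq
  have hne : (((q + δ ^ 2 - lam ^ 2 : ℝ) : ℂ) - (2 * lam * δ : ℝ) * Complex.I) ≠ 0 := by
    intro h
    rw [h, zero_mul] at h2
    exact hD.ne (by exact_mod_cast h2)
  have hpic : (Real.pi : ℂ) ≠ 0 := by exact_mod_cast hpi.ne'
  have hDc : (((q + δ ^ 2 - lam ^ 2) ^ 2 + (2 * lam * δ) ^ 2 : ℝ) : ℂ) ≠ 0 := by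
    exact_mod_cast hD.ne'
  have h3 : (4 * Real.pi / ((2 * Real.pi * (δ - lam * Complex.I)) ^ 2 +
      4 * Real.pi ^ 2 * (q : ℂ)) : ℂ) =
      (((q + δ ^ 2 - lam ^ 2) / (Real.pi * ((q + δ ^ 2 - lam ^ 2) ^ 2 + (2 * lam * δ) ^ 2)) : ℝ) :
        ℂ) + ((2 * lam * δ / (Real.pi * ((q + δ ^ 2 - lam ^ 2) ^ 2 + (2 * lam * δ) ^ 2)) : ℝ) : ℂ)
        * Complex.I := by
    rw [h1, div_eq_iff (mul_ne_zero (mul_ne_zero (by norm_num) (pow_ne_zero 2 hpic)) hne)]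
    have h4 : (((q + δ ^ 2 - lam ^ 2) /
        (Real.pi * ((q + δ ^ 2 - lam ^ 2) ^ 2 + (2 * lam * δ) ^ 2)) : ℝ) : ℂ) +
        ((2 * lam * δ / (Real.pi * ((q + δ ^ 2 - lam ^ 2) ^ 2 + (2 * lam * δ) ^ 2)) : ℝ) : ℂ)
        * Complex.I = (((q + δ ^ 2 - lam ^ 2 : ℝ) : ℂ) + (2 * lam * δ : ℝ) * Complex.I) /
          (Real.pi * (((q + δ ^ 2 - lam ^ 2) ^ 2 + (2 * lam * δ) ^ 2 : ℝ) : ℂ)) := by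
      rw [Complex.ofReal_div, Complex.ofReal_div, Complex.ofReal_mul]
      field_simp
    rw [h4, div_mul_eq_mul_div, eq_div_iff (mul_ne_zero hpic hDc), ← h2]
    ring
  rw [h3]
  simp [-Complex.ofReal_div]

lemma le_im_yukawa_symbol {lam δ q : ℝ} (hl : 1 < lam) (hδ : 0 < δ) (hδ1 : δ < 1) (hq : 0 ≤ q)
    (h : |√q - lam| < δ) :
    1 / (10 * Real.pi * (lam * δ)) ≤
      2 * lam * δ / (Real.pi * ((q + δ ^ 2 - lam ^ 2) ^ 2 + (2 * lam * δ) ^ 2)) := by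
  have hpi := Real.pi_pos
  obtain ⟨h1, h2⟩ := abs_lt.1 h
  have hs := Real.sq_sqrt hq
  have hs0 := Real.sqrt_nonneg q
  set e := √q
  have hld : 0 < lam * δ := by positivity
  have hx : |q + δ ^ 2 - lam ^ 2| ≤ 4 * (lam * δ) := by
    rw [abs_le]
    constructor <;> nlinarith
  have hx2 : (q + δ ^ 2 - lam ^ 2) ^ 2 ≤ 16 * (lam * δ) ^ 2 := by
    have := sq_le_sq' (abs_le.1 hx).1 (abs_le.1 hx).2
    linarith
  have hD : 0 < (q + δ ^ 2 - lam ^ 2) ^ 2 + (2 * lam * δ) ^ 2 := by positivity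
  rw [div_le_div_iff₀ (by positivity) (by positivity)]
  have : Real.pi * ((q + δ ^ 2 - lam ^ 2) ^ 2 + (2 * lam * δ) ^ 2) ≤
      Real.pi * (20 * (lam * δ) ^ 2) := by
    gcongr
    linarith
  linarith

open ComplexConjugate in
lemma exists_norm_integral_yukawa_mul_autocorrelation_le {s : ℝ} (hs : 1 < s) :
    ∃ C : ℝ, 0 < C ∧ ∀ (lam δ m : ℝ) (g : UnitAddTorus (Fin 3) → ℂ), 0 < δ → 0 < m →
      Measurable g → (∀ x, ‖g x‖ ≤ 1) → ∫⁻ x, ‖g x‖ₑ ≤ ENNReal.ofReal m →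
      ‖∫ z, yukawaRadial (2 * Real.pi * (δ - lam * Complex.I)) (euclid z) *
        ∫ x, conj (g x) * g (x + toTorus z)‖ ≤
      C * (m ^ (5 / 3 : ℝ) + m ^ 2 * δ ^ (-(1 + s))) := by
  obtain ⟨C, hC, hmain⟩ := exists_lintegral_kernel_le hs
  refine ⟨C, hC, fun lam δ m g hδ hm hg hg1 hgm => ?_⟩
  set ρ : UnitAddTorus (Fin 3) → ENNReal := fun y => ∫⁻ x, ‖g x‖ₑ * ‖g (x + y)‖ₑ with hρ
  have hjoint : Measurable fun w : UnitAddTorus (Fin 3) × UnitAddTorus (Fin 3) =>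
      ‖g w.2‖ₑ * ‖g (w.2 + w.1)‖ₑ := by fun_prop
  have hρmeas : Measurable ρ := hjoint.lintegral_prod_right'
  have hρm : ∀ y, ρ y ≤ ENNReal.ofReal m := by
    intro y
    refine (lintegral_mono fun x => ?_).trans hgm
    calc ‖g x‖ₑ * ‖g (x + y)‖ₑ ≤ ‖g x‖ₑ * 1 := by
          gcongr
          rw [← ofReal_norm]
          exact ENNReal.ofReal_le_one.2 (hg1 _)
      _ = ‖g x‖ₑ := mul_one _
  have hρi : ∫⁻ y, ρ y ≤ ENNReal.ofReal (m ^ 2) := by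
    simp only [hρ]
    rw [lintegral_lintegral_swap hjoint.aemeasurable]
    have h1 : ∀ x, ∫⁻ y, ‖g x‖ₑ * ‖g (x + y)‖ₑ = ‖g x‖ₑ * ∫⁻ y, ‖g y‖ₑ := by
      intro x
      rw [lintegral_const_mul _ (by fun_prop), lintegral_add_left_eq_self (fun y => ‖g y‖ₑ) x]
    simp_rw [h1]
    rw [lintegral_mul_const _ (by fun_prop), sq, ENNReal.ofReal_mul hm.le]
    exact mul_le_mul' hgm hgm
  have h := hmain δ m ρ hδ hm hρmeas hρm hρi
  have hnn : 0 ≤ C * (m ^ (5 / 3 : ℝ) + m ^ 2 * δ ^ (-(1 + s))) := by positivity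
  rw [← ENNReal.ofReal_le_ofReal_iff hnn, ofReal_norm]
  refine (enorm_integral_le_lintegral_enorm _).trans ((lintegral_mono fun z => ?_).trans h)
  rw [enorm_mul]
  refine mul_le_mul' ?_ ((enorm_integral_le_lintegral_enorm _).trans_eq ?_)
  · rw [← ofReal_norm, norm_yukawaRadial _ (by exact Real.sqrt_nonneg _)]
    simp
  · simp [hρ, enorm_mul]

/-- Restriction estimate for the shell: the Fourier coefficients in the shell of a function of
modulus at most one and mass at most `m`. -/
lemma exists_sum_sq_norm_mFourierCoeff_le {s : ℝ} (hs : 1 < s) :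
    ∃ C : ℝ, 0 < C ∧ ∀ (lam δ m : ℝ) (g : UnitAddTorus (Fin 3) → ℂ), 1 < lam → 0 < δ → δ < 1 →
      0 < m → Measurable g → (∀ x, ‖g x‖ ≤ 1) → ∫⁻ x, ‖g x‖ₑ ≤ ENNReal.ofReal m →
      ∀ S : Finset (Fin 3 → ℤ), (∀ k ∈ S, |√(∑ i, (k i : ℝ) ^ 2) - lam| < δ) →
      ∑ k ∈ S, ‖UnitAddTorus.mFourierCoeff g k‖ ^ 2 ≤
        C * (lam * δ) * (m ^ (5 / 3 : ℝ) + m ^ 2 * δ ^ (-(1 + s))) := by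
  obtain ⟨C, hC, hmain⟩ := exists_norm_integral_yukawa_mul_autocorrelation_le hs
  have hpi := Real.pi_pos
  refine ⟨10 * Real.pi * C, by positivity, fun lam δ m g hl hδ hδ1 hm hg hg1 hgm S hS => ?_⟩
  have hre : 0 < (2 * Real.pi * (δ - lam * Complex.I) : ℂ).re := by
    simp
    positivity
  have hsum := Complex.hasSum_im (hasSum_yukawa_mul_autocorrelation hre hg hg1)
  simp_rw [Complex.im_ofReal_mul, im_yukawa_symbol (zero_lt_one.trans hl) hδ] at hsum
  have hSle := sum_le_hasSum S (fun k _ => by positivity) hsum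
  have hub := hSle.trans ((Complex.im_le_norm _).trans (hmain lam δ m g hδ hm hg hg1 hgm))
  have hlb : (∑ k ∈ S, ‖UnitAddTorus.mFourierCoeff g k‖ ^ 2) * (1 / (10 * Real.pi * (lam * δ))) ≤
      C * (m ^ (5 / 3 : ℝ) + m ^ 2 * δ ^ (-(1 + s))) := by
    refine le_trans ?_ hub
    rw [Finset.sum_mul]
    refine Finset.sum_le_sum fun k hk => ?_
    exact mul_le_mul_of_nonneg_left (le_im_yukawa_symbol hl hδ hδ1 (by positivity) (hS k hk))
      (by positivity)
  rw [mul_one_div, div_le_iff₀ (by positivity)] at hlb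
  linarith

def torusCube (r : ℝ) : Set (UnitAddTorus (Fin 3)) :=
  Set.univ.pi fun _ => Metric.closedBall (0 : UnitAddCircle) r

lemma measurableSet_torusCube (r : ℝ) : MeasurableSet (torusCube r) :=
  MeasurableSet.univ_pi fun _ => Metric.isClosed_closedBall.measurableSet

lemma haarAddCircle_closedBall (x : UnitAddCircle) {r : ℝ} (hr : 2 * r ≤ 1) :
    (AddCircle.haarAddCircle : Measure UnitAddCircle) (Metric.closedBall x r) =
      ENNReal.ofReal (2 * r) := by
  have h := AddCircle.volume_closedBall (T := 1) (x := x) r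
  rw [AddCircle.volume_eq_smul_haarAddCircle, min_eq_right hr] at h
  simpa using h

lemma volume_torusCube {r : ℝ} (hr0 : 0 ≤ r) (hr : 2 * r ≤ 1) :
    volume (torusCube r) = ENNReal.ofReal ((2 * r) ^ 3) := by
  rw [torusCube, volume_pi_pi]
  refine (Finset.prod_congr rfl fun _ _ => haarAddCircle_closedBall 0 hr).trans ?_
  rw [Finset.prod_const, Finset.card_univ, Fintype.card_fin, ENNReal.ofReal_pow (by positivity)]

lemma exists_toTorus_eq_of_mem_torusCube {r : ℝ} {x : UnitAddTorus (Fin 3)}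
    (hx : x ∈ torusCube r) : ∃ z : Fin 3 → ℝ, toTorus z = x ∧ ∀ i, |z i| ≤ r := by
  have h : ∀ i, ∃ t : ℝ, (t : UnitAddCircle) = x i ∧ |t| ≤ r := by
    intro i
    have hi : ‖x i‖ ≤ r := by simpa using hx i (Set.mem_univ i)
    induction hxi : x i using QuotientAddGroup.induction_on with
    | H t =>
      rw [hxi, UnitAddCircle.norm_eq] at hi
      refine ⟨t - round t, ?_, hi⟩
      rw [AddCircle.coe_sub, sub_eq_self]
      exact (AddCircle.coe_eq_zero_iff 1).2 ⟨round t, by simp⟩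
  choose z hz hzr using h
  exact ⟨z, funext hz, hzr⟩

lemma half_le_re_mFourier_of_mem_torusCube {lam : ℝ} (hl : 0 < lam) {k : Fin 3 → ℤ}
    (hk : ∀ i, |(k i : ℝ)| ≤ 2 * lam) {x : UnitAddTorus (Fin 3)}
    (hx : x ∈ torusCube (1 / (100 * lam))) :
    1 / 2 ≤ (UnitAddTorus.mFourier (-k) x).re := by
  obtain ⟨z, rfl, hz⟩ := exists_toTorus_eq_of_mem_torusCube hx
  have hsum : |∑ i, ((-k) i : ℝ) * z i| ≤ 6 / 100 := by
    calc |∑ i, ((-k) i : ℝ) * z i| ≤ ∑ i, |((-k) i : ℝ) * z i| := Finset.abs_sum_le_sum_abs _ _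
      _ ≤ ∑ _i : Fin 3, (2 * lam) * (1 / (100 * lam)) := by
          refine Finset.sum_le_sum fun i _ => ?_
          rw [abs_mul]
          refine mul_le_mul ?_ (hz i) (abs_nonneg _) (by positivity)
          simpa using hk i
      _ = 6 / 100 := by
          simp only [Finset.sum_const, Finset.card_univ, Fintype.card_fin]
          field_simp
          norm_num
  rw [mFourier_toTorus]
  set t := ∑ i, ((-k) i : ℝ) * z i
  have : (2 * Real.pi * Complex.I * (t : ℂ)) = ((2 * Real.pi * t : ℝ) : ℂ) * Complex.I := by
    push_cast
    ring
  rw [this, Complex.exp_ofReal_mul_I_re]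
  have h1 := Real.one_sub_sq_div_two_le_cos (x := 2 * Real.pi * t)
  have h2 : (2 * Real.pi * t) ^ 2 ≤ (2 * 4 * (6 / 100)) ^ 2 := by
    rw [← sq_abs, abs_mul, abs_of_pos (by positivity)]
    have := Real.pi_le_four
    gcongr
  linarith

lemma abs_le_sqrt_sum_sq (k : Fin 3 → ℤ) (i : Fin 3) : |(k i : ℝ)| ≤ √(∑ i, (k i : ℝ) ^ 2) := by
  rw [← Real.sqrt_sq_eq_abs]
  exact Real.sqrt_le_sqrt (Finset.single_le_sum (f := fun i => (k i : ℝ) ^ 2)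
    (fun j _ => sq_nonneg _) (Finset.mem_univ i))

/-- Bound for the number of lattice points in the shell. -/
lemma exists_card_shell_le {s : ℝ} (hs : 1 < s) :
    ∃ C : ℝ, 0 < C ∧ ∀ lam δ : ℝ, 1 < lam → 0 < δ → δ < 1 →
      ∀ S : Finset (Fin 3 → ℤ), (∀ k ∈ S, |√(∑ i, (k i : ℝ) ^ 2) - lam| < δ) →
      (S.card : ℝ) ≤ C * (lam * δ) * (lam + δ ^ (-(1 + s))) := by
  obtain ⟨C, hC, hmain⟩ := exists_sum_sq_norm_mFourierCoeff_le hs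
  refine ⟨200 * C, by positivity, fun lam δ hl hδ hδ1 S hS => ?_⟩
  have hl0 : 0 < lam := by linarith
  set r := 1 / (100 * lam) with hr
  have hr0 : 0 < r := by positivity
  have hr2 : 2 * r ≤ 1 := by
    rw [hr, mul_one_div, div_le_one (by positivity)]
    linarith
  set E := torusCube r
  have hE : MeasurableSet E := measurableSet_torusCube r
  set m := (2 * r) ^ 3 with hm
  have hm0 : 0 < m := by positivity
  have hEm : volume E = ENNReal.ofReal m := volume_torusCube hr0.le hr2
  set g : UnitAddTorus (Fin 3) → ℂ := E.indicator 1 with hg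
  have hgm : Measurable g := measurable_one.indicator hE
  have hg1 : ∀ x, ‖g x‖ ≤ 1 := fun x => by
    by_cases hx : x ∈ E <;> simp [hg, hx]
  have hgi : ∫⁻ x, ‖g x‖ₑ ≤ ENNReal.ofReal m := by
    rw [← hEm, ← lintegral_indicator_one hE]
    refine lintegral_mono fun x => ?_
    by_cases hx : x ∈ E <;> simp [hg, hx]
  have h := hmain lam δ m g hl hδ hδ1 hm0 hgm hg1 hgi S hS
  have hcoeff : ∀ k ∈ S, m ^ 2 / 4 ≤ ‖UnitAddTorus.mFourierCoeff g k‖ ^ 2 := by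
    intro k hk
    have hk2 : ∀ i, |(k i : ℝ)| ≤ 2 * lam := fun i => by
      linarith [abs_le_sqrt_sum_sq k i, (abs_lt.1 (hS k hk)).2]
    have heq : UnitAddTorus.mFourierCoeff g k = ∫ x in E, UnitAddTorus.mFourier (-k) x := by
      rw [UnitAddTorus.mFourierCoeff, ← integral_indicator hE]
      congr 1
      funext x
      by_cases hx : x ∈ E <;> simp [hg, hx]
    have hint : IntegrableOn (fun x => UnitAddTorus.mFourier (-k) x) E :=
      ((UnitAddTorus.mFourier (-k)).continuous.integrable_of_hasCompactSupport
        (HasCompactSupport.of_compactSpace _)).integrableOn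
    have hre : m / 2 ≤ (UnitAddTorus.mFourierCoeff g k).re := by
      rw [heq]
      have h1 : (∫ x in E, UnitAddTorus.mFourier (-k) x).re =
          ∫ x in E, (UnitAddTorus.mFourier (-k) x).re := (integral_re hint).symm
      have h2 : ∫ _x in E, (1 / 2 : ℝ) = m / 2 := by
        rw [setIntegral_const, Measure.real, hEm, ENNReal.toReal_ofReal hm0.le, smul_eq_mul]
        ring
      rw [h1, ← h2]
      exact setIntegral_mono_on (integrable_const _) hint.re hE
        fun x hx => half_le_re_mFourier_of_mem_torusCube hl0 hk2 hx
    have h3 := hre.trans (Complex.re_le_norm _)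
    calc m ^ 2 / 4 = (m / 2) ^ 2 := by ring
      _ ≤ _ := by gcongr
  have hlow : (S.card : ℝ) * (m ^ 2 / 4) ≤ ∑ k ∈ S, ‖UnitAddTorus.mFourierCoeff g k‖ ^ 2 := by
    rw [← nsmul_eq_mul, ← Finset.sum_const]
    exact Finset.sum_le_sum hcoeff
  have hm53 : m ^ (5 / 3 : ℝ) = m ^ 2 * (50 * lam) := by
    have h1 : m ^ (5 / 3 : ℝ) = (2 * r) ^ 5 := by
      rw [hm, ← Real.rpow_natCast, ← Real.rpow_natCast, ← Real.rpow_mul (by positivity)]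
      norm_num
    rw [h1, hm, hr]
    field_simp
    norm_num
  have hfin := hlow.trans h
  rw [hm53] at hfin
  have hcan : (S.card : ℝ) * m ^ 2 ≤
      (4 * C * (lam * δ) * (50 * lam + δ ^ (-(1 + s)))) * m ^ 2 := by linarith
  refine (le_of_mul_le_mul_right hcan (by positivity)).trans ?_
  have : 0 ≤ C * (lam * δ) * δ ^ (-(1 + s)) := by positivity
  linarith

noncomputable def torusSum (S : Finset (Fin 3 → ℤ)) (a : (Fin 3 → ℤ) → ℂ)
    (x : UnitAddTorus (Fin 3)) : ℂ :=
  ∑ k ∈ S, a k * UnitAddTorus.mFourier k x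

lemma continuous_torusSum (S : Finset (Fin 3 → ℤ)) (a : (Fin 3 → ℤ) → ℂ) :
    Continuous (torusSum S a) :=
  continuous_finsetSum _ fun k _ => continuous_const.mul (UnitAddTorus.mFourier k).continuous

lemma norm_torusSum_sq_le (S : Finset (Fin 3 → ℤ)) (a : (Fin 3 → ℤ) → ℂ)
    (x : UnitAddTorus (Fin 3)) :
    ‖torusSum S a x‖ ^ 2 ≤ (∑ k ∈ S, ‖a k‖ ^ 2) * S.card := by
  have h1 : ‖torusSum S a x‖ ≤ ∑ k ∈ S, ‖a k‖ * 1 := by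
    refine (norm_sum_le _ _).trans_eq (Finset.sum_congr rfl fun k _ => ?_)
    rw [norm_mul, norm_mFourier_apply]
  calc ‖torusSum S a x‖ ^ 2 ≤ (∑ k ∈ S, ‖a k‖ * 1) ^ 2 := by gcongr
    _ ≤ (∑ k ∈ S, ‖a k‖ ^ 2) * ∑ k ∈ S, (1 : ℝ) ^ 2 := Finset.sum_mul_sq_le_sq_mul_sq _ _ _
    _ = _ := by simp

open ComplexConjugate in
lemma integral_torusSum_mul_conj (S : Finset (Fin 3 → ℤ)) (a : (Fin 3 → ℤ) → ℂ)
    {g : UnitAddTorus (Fin 3) → ℂ} (hg : Measurable g) (hg1 : ∀ x, ‖g x‖ ≤ 1) :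
    ∫ x, torusSum S a x * conj (g x) =
      ∑ k ∈ S, a k * conj (UnitAddTorus.mFourierCoeff g k) := by
  have hgc : Measurable fun x => conj (g x) := Complex.continuous_conj.measurable.comp hg
  have hint : ∀ k ∈ S, Integrable fun x => a k * UnitAddTorus.mFourier k x * conj (g x) := by
    intro k _
    have hm := (UnitAddTorus.mFourier k).continuous.measurable
    refine Integrable.of_bound (C := ‖a k‖) (by fun_prop)
      (Filter.Eventually.of_forall fun x => ?_)
    rw [norm_mul, norm_mul, norm_mFourier_apply, mul_one, RCLike.norm_conj]
    exact mul_le_of_le_one_right (norm_nonneg _) (hg1 x)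
  simp only [torusSum, Finset.sum_mul]
  rw [integral_finsetSum _ hint]
  refine Finset.sum_congr rfl fun k _ => ?_
  simp_rw [mul_assoc]
  rw [integral_const_mul, UnitAddTorus.mFourierCoeff, ← integral_conj]
  congr 2
  funext x
  simp [UnitAddTorus.mFourier_neg]

open ComplexConjugate in
lemma exists_dual_function (S : Finset (Fin 3 → ℤ)) (a : (Fin 3 → ℤ) → ℂ) {α : ℝ} (hα : 0 < α) :
    ∃ g : UnitAddTorus (Fin 3) → ℂ, Measurable g ∧ (∀ x, ‖g x‖ ≤ 1) ∧
      ∫⁻ x, ‖g x‖ₑ ≤ volume {x | α < ‖torusSum S a x‖} ∧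
      (α * volume.real {x | α < ‖torusSum S a x‖}) ^ 2 ≤
        (∑ k ∈ S, ‖a k‖ ^ 2) * ∑ k ∈ S, ‖UnitAddTorus.mFourierCoeff g k‖ ^ 2 := by
  set F := torusSum S a with hF
  have hFm : Measurable F := (continuous_torusSum S a).measurable
  set E := {x | α < ‖F x‖}
  have hE : MeasurableSet E := measurableSet_lt measurable_const hFm.norm
  set g : UnitAddTorus (Fin 3) → ℂ := E.indicator fun x => F x / (‖F x‖ : ℂ) with hg
  have hgm : Measurable g := Measurable.indicator (by fun_prop) hE
  have hgn : ∀ x, ‖g x‖ ≤ E.indicator 1 x := by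
    intro x
    by_cases hx : x ∈ E
    · simp [hg, hx, div_self_le_one]
    · simp [hg, hx]
  have hg1 : ∀ x, ‖g x‖ ≤ 1 := fun x =>
    (hgn x).trans (Set.indicator_le_self' (fun _ _ => zero_le_one) x)
  refine ⟨g, hgm, hg1, ?_, ?_⟩
  · rw [← lintegral_indicator_one hE]
    refine lintegral_mono fun x => ?_
    rw [← ofReal_norm]
    refine (ENNReal.ofReal_le_ofReal (hgn x)).trans_eq ?_
    by_cases hx : x ∈ E <;> simp [hx]
  · have hpt : ∀ x, (F x * conj (g x)) = ((E.indicator (fun x => ‖F x‖) x : ℝ) : ℂ) := by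
      intro x
      by_cases hx : x ∈ E
      · have h0 : (‖F x‖ : ℂ) ≠ 0 := by
          have : (0 : ℝ) < ‖F x‖ := hα.trans hx
          exact_mod_cast this.ne'
        simp only [hg, Set.indicator_of_mem hx, map_div₀, Complex.conj_ofReal]
        rw [← mul_div_assoc, Complex.mul_conj, Complex.normSq_eq_norm_sq, div_eq_iff h0]
        push_cast
        ring
      · simp [hg, hx]
    have hbase := integral_torusSum_mul_conj S a hgm hg1
    rw [← hF] at hbase
    simp_rw [hpt] at hbase
    rw [integral_complex_ofReal, integral_indicator hE] at hbase
    have hFint : IntegrableOn (fun x => ‖F x‖) E :=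
      ((continuous_torusSum S a).norm.integrable_of_hasCompactSupport
        (HasCompactSupport.of_compactSpace _)).integrableOn
    have hlow : α * volume.real E ≤ ∫ x in E, ‖F x‖ := by
      have h2 : ∫ _x in E, α = α * volume.real E := by
        rw [setIntegral_const, smul_eq_mul, mul_comm]
      rw [← h2]
      exact setIntegral_mono_on (integrable_const _) hFint hE fun x hx => le_of_lt hx
    have hup : ∫ x in E, ‖F x‖ ≤ ∑ k ∈ S, ‖a k‖ * ‖UnitAddTorus.mFourierCoeff g k‖ := by
      calc ∫ x in E, ‖F x‖ ≤ ‖((∫ x in E, ‖F x‖ : ℝ) : ℂ)‖ := by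
            rw [Complex.norm_real]
            exact le_abs_self _
        _ ≤ _ := by
            rw [hbase]
            refine (norm_sum_le _ _).trans_eq (Finset.sum_congr rfl fun k _ => ?_)
            rw [norm_mul, RCLike.norm_conj]
    calc (α * volume.real E) ^ 2
        ≤ (∑ k ∈ S, ‖a k‖ * ‖UnitAddTorus.mFourierCoeff g k‖) ^ 2 := by
          have : 0 ≤ α * volume.real E := by positivity
          gcongr
          exact hlow.trans hup
      _ ≤ _ := Finset.sum_mul_sq_le_sq_mul_sq _ _ _

lemma measureReal_level_le (S : Finset (Fin 3 → ℤ)) (a : (Fin 3 → ℤ) → ℂ) {α : ℝ} (hα : 0 < α) :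
    volume.real {x | α < ‖torusSum S a x‖} ≤ (∑ k ∈ S, ‖a k‖ ^ 2) * α ^ (-2 : ℝ) := by
  obtain ⟨g, hg, hg1, hgE, h⟩ := exists_dual_function S a hα
  set m := volume.real {x | α < ‖torusSum S a x‖} with hm
  set B := ∑ k ∈ S, ‖a k‖ ^ 2
  have hB : 0 ≤ B := by positivity
  have hm_nonneg : 0 ≤ m := measureReal_nonneg
  rcases hm_nonneg.eq_or_lt with h0 | hm0
  · rw [← h0]
    positivity
  have hbessel : ∑ k ∈ S, ‖UnitAddTorus.mFourierCoeff g k‖ ^ 2 ≤ m := by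
    refine (sum_le_hasSum S (fun k _ => by positivity)
      (hasSum_sq_norm_mFourierCoeff hg hg1)).trans ?_
    have hle : ∀ x, ‖g x‖ ^ 2 ≤ ‖g x‖ := fun x => by
      rw [sq]
      exact mul_le_of_le_one_left (norm_nonneg _) (hg1 x)
    have hi : Integrable g := (memLp_two_of_norm_le_one hg hg1).integrable (by norm_num)
    have hi2 : Integrable fun x => ‖g x‖ ^ 2 :=
      (memLp_two_of_norm_le_one hg hg1).integrable_norm_pow (by norm_num)
    refine (integral_mono hi2 hi.norm hle).trans ?_
    rw [integral_norm_eq_lintegral_enorm hg.aestronglyMeasurable]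
    exact ENNReal.toReal_mono (measure_ne_top _ _) hgE
  have h2 : α ^ 2 * m * m ≤ B * m := by
    calc α ^ 2 * m * m = (α * m) ^ 2 := by ring
      _ ≤ _ := h.trans (by gcongr)
  rw [Real.rpow_neg hα.le, ← div_eq_mul_inv, Real.rpow_two, le_div_iff₀ (by positivity)]
  linarith [le_of_mul_le_mul_right h2 hm0]

/-- Level set estimate above the threshold height. -/
lemma exists_measureReal_level_le {s : ℝ} (hs : 1 < s) :
    ∃ C : ℝ, 0 < C ∧ ∀ (lam δ : ℝ) (S : Finset (Fin 3 → ℤ)) (a : (Fin 3 → ℤ) → ℂ),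
      1 < lam → 0 < δ → δ < 1 → (∀ k ∈ S, |√(∑ i, (k i : ℝ) ^ 2) - lam| < δ) →
      ∀ α, 0 < α → C * (∑ k ∈ S, ‖a k‖ ^ 2) * (lam * δ ^ (-s)) ≤ α ^ 2 →
      volume.real {x | α < ‖torusSum S a x‖} ≤
        (C * (∑ k ∈ S, ‖a k‖ ^ 2) * (lam * δ)) ^ 3 * α ^ (-6 : ℝ) := by
  obtain ⟨C, hC, hmain⟩ := exists_sum_sq_norm_mFourierCoeff_le hs
  refine ⟨2 * C, by positivity, fun lam δ S a hl hδ hδ1 hS α hα hαL => ?_⟩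
  obtain ⟨g, hg, hg1, hgE, h⟩ := exists_dual_function S a hα
  set m := volume.real {x | α < ‖torusSum S a x‖} with hm
  set B := ∑ k ∈ S, ‖a k‖ ^ 2
  have hB : 0 ≤ B := by positivity
  have hm_nonneg : 0 ≤ m := measureReal_nonneg
  rcases hm_nonneg.eq_or_lt with h0 | hm0
  · rw [← h0]
    positivity
  have hgm : ∫⁻ x, ‖g x‖ₑ ≤ ENNReal.ofReal m := by
    rwa [hm, ofReal_measureReal]
  have h1 := hmain lam δ m g hl hδ hδ1 hm0 hg hg1 hgm S hS
  have hδs : δ ^ (-s) = δ * δ ^ (-(1 + s)) := by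
    nth_rewrite 2 [← Real.rpow_one δ]
    rw [← Real.rpow_add hδ]
    congr 1
    ring
  set t := m ^ (1 / 3 : ℝ) with ht
  have ht0 : 0 < t := by positivity
  have ht3 : m = t ^ 3 := by
    rw [ht, ← Real.rpow_natCast, ← Real.rpow_mul hm0.le]; norm_num
  have hm53 : m ^ (5 / 3 : ℝ) = t ^ 5 := by
    rw [ht, ← Real.rpow_natCast, ← Real.rpow_mul hm0.le]; norm_num
  rw [hm53] at h1
  have h2 := h.trans (mul_le_mul_of_nonneg_left h1 hB)
  have h3 : 2 * C * B * (lam * δ ^ (-s)) * m ^ 2 ≤ α ^ 2 * m ^ 2 := by gcongr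
  rw [hδs] at h3
  have h4 : α ^ 2 * m ^ 2 ≤ 2 * C * B * (lam * δ) * t ^ 5 := by linarith
  have h5 : α ^ 2 * t ≤ 2 * C * B * (lam * δ) := by
    refine le_of_mul_le_mul_right ?_ (pow_pos ht0 5)
    calc α ^ 2 * t * t ^ 5 = α ^ 2 * m ^ 2 := by rw [ht3]; ring
      _ ≤ _ := h4
  rw [Real.rpow_neg hα.le, ← div_eq_mul_inv, le_div_iff₀ (by positivity), ht3]
  calc t ^ 3 * α ^ (6 : ℝ) = (α ^ 2 * t) ^ 3 := by
        rw [show (6 : ℝ) = (6 : ℕ) by norm_num, Real.rpow_natCast]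
        ring
    _ ≤ _ := by gcongr

lemma lintegral_Ioi_indicator_rpow {q T : ℝ} (hq : 0 < q) (hT : 0 ≤ T) :
    ∫⁻ t in Set.Ioi (0 : ℝ), (Set.Iic T).indicator (fun t => ENNReal.ofReal (t ^ (q - 1))) t =
      ENNReal.ofReal (T ^ q / q) := by
  rw [lintegral_indicator measurableSet_Iic, Measure.restrict_restrict measurableSet_Iic,
    Set.inter_comm, Set.Ioi_inter_Iic]
  have hi : IntegrableOn (fun t : ℝ => t ^ (q - 1)) (Set.Ioc 0 T) :=
    (intervalIntegrable_iff_integrableOn_Ioc_of_le hT).1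
      (intervalIntegral.intervalIntegrable_rpow' (by linarith))
  rw [← ofReal_integral_eq_lintegral_ofReal hi]
  · rw [← intervalIntegral.integral_of_le hT, integral_rpow (Or.inl (by linarith)),
      sub_add_cancel, Real.zero_rpow hq.ne', sub_zero]
  · exact (ae_restrict_iff' measurableSet_Ioc).2
      (Filter.Eventually.of_forall fun t ht => Real.rpow_nonneg ht.1.le _)

/-- Layer cake bound from a two-regime tail estimate and a uniform bound. -/
lemma lintegral_rpow_le_of_tail {X : Type*} [MeasurableSpace X] (μ : Measure X)
    [IsFiniteMeasure μ] {f : X → ℝ} (hf : Measurable f) (hf0 : ∀ x, 0 ≤ f x) {p T A B D : ℝ}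
    (hp : 6 < p) (hT : 0 ≤ T) (hA : 0 ≤ A) (hB : 0 ≤ B) (hD : 0 ≤ D)
    (h1 : ∀ t, 0 < t → μ.real {x | t < f x} ≤ B * t ^ (-2 : ℝ))
    (h2 : ∀ t, 0 < t → T ≤ t → μ.real {x | t < f x} ≤ D * t ^ (-6 : ℝ)) (h3 : ∀ x, f x ≤ A) :
    ∫⁻ x, ENNReal.ofReal (f x ^ p) ∂μ ≤
      ENNReal.ofReal (p * (B * (T ^ (p - 2) / (p - 2)) + D * (A ^ (p - 6) / (p - 6)))) := by
  have hp2 : 0 < p - 2 := by linarith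
  have hp6 : 0 < p - 6 := by linarith
  rw [lintegral_rpow_eq_lintegral_meas_lt_mul μ (Filter.Eventually.of_forall hf0) hf.aemeasurable
    (by linarith), ENNReal.ofReal_mul (by linarith)]
  refine mul_le_mul' le_rfl ?_
  rw [ENNReal.ofReal_add (by positivity) (by positivity), ENNReal.ofReal_mul hB,
    ENNReal.ofReal_mul hD, ← lintegral_Ioi_indicator_rpow hp2 hT,
    ← lintegral_Ioi_indicator_rpow hp6 hA]
  have hmeas : ∀ q T : ℝ, Measurable
      ((Set.Iic T).indicator fun t : ℝ => ENNReal.ofReal (t ^ (q - 1))) := fun q T =>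
    Measurable.indicator (by fun_prop) measurableSet_Iic
  rw [← lintegral_const_mul _ (hmeas _ _), ← lintegral_const_mul _ (hmeas _ _),
    ← lintegral_add_left ((hmeas _ _).const_mul _)]
  refine setLIntegral_mono' measurableSet_Ioi fun t ht => ?_
  have ht : 0 < t := ht
  have hcomb : ∀ c q : ℝ, 0 ≤ c → μ.real {x | t < f x} ≤ c * t ^ (-q) →
      μ {x | t < f x} * ENNReal.ofReal (t ^ (p - 1)) ≤
        ENNReal.ofReal c * ENNReal.ofReal (t ^ (p - q - 1)) := by
    intro c q hc h
    rw [← ofReal_measureReal, ← ENNReal.ofReal_mul measureReal_nonneg, ← ENNReal.ofReal_mul hc]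
    apply ENNReal.ofReal_le_ofReal
    calc μ.real {x | t < f x} * t ^ (p - 1) ≤ c * t ^ (-q) * t ^ (p - 1) := by gcongr
      _ = c * t ^ (p - q - 1) := by
        rw [mul_assoc, ← Real.rpow_add ht]
        congr 2
        ring
  rcases le_or_gt t T with htT | htT
  · refine le_add_right ?_
    rw [Set.indicator_of_mem (by exact htT)]
    exact hcomb B 2 hB (h1 t ht)
  refine le_add_left ?_
  rcases le_or_gt t A with htA | htA
  · rw [Set.indicator_of_mem (by exact htA)]
    exact hcomb D 6 hD (h2 t ht htT.le)
  · have : {x | t < f x} = ∅ := Set.eq_empty_of_forall_notMem fun x hx =>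
      absurd ((h3 x).trans_lt htA) (not_lt.2 (le_of_lt hx))
    simp [this]

lemma exists_lintegral_torusSum_rpow_le {p : ℝ} (hp : 6 < p) :
    ∃ C : ℝ, 0 < C ∧ ∀ (lam δ : ℝ) (S : Finset (Fin 3 → ℤ)) (a : (Fin 3 → ℤ) → ℂ),
      1 < lam → 0 < δ → δ < 1 → lam ^ (-(1 / 2 : ℝ) + 3 / p) ≤ δ →
      (∀ k ∈ S, |√(∑ i, (k i : ℝ) ^ 2) - lam| < δ) → 0 < ∑ k ∈ S, ‖a k‖ ^ 2 →
      ∫⁻ x, ENNReal.ofReal (‖torusSum S a x‖ ^ p) ≤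
        ENNReal.ofReal (C * ((∑ k ∈ S, ‖a k‖ ^ 2) ^ (p / 2) * (lam ^ (p - 3) * δ ^ (p / 2)))) := by
  have hp6 : 0 < p - 6 := by linarith
  have hp2 : 0 < p - 2 := by linarith
  have hp0 : 0 < p := by linarith
  set s := p / (p - 6) with hs_def
  have hs : 1 < s := by
    rw [hs_def, lt_div_iff₀ hp6]
    linarith
  obtain ⟨C₁, hC₁, hcard⟩ := exists_card_shell_le hs
  obtain ⟨C₂, hC₂, hlevel⟩ := exists_measureReal_level_le hs
  refine ⟨p * (C₂ ^ ((p - 2) / 2) / (p - 2) + C₂ ^ 3 * (2 * C₁) ^ ((p - 6) / 2) / (p - 6)),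
    by positivity, fun lam δ S a hl hδ hδ1 hlδ hS hBpos => ?_⟩
  set B := ∑ k ∈ S, ‖a k‖ ^ 2 with hB_def
  have hl0 : 0 < lam := by linarith
  have hδs : δ ^ (-s) ≤ lam ^ (1 / 2 : ℝ) := by
    have h1 : (lam ^ (-(1 / 2 : ℝ) + 3 / p)) ^ s ≤ δ ^ s := by gcongr
    rw [← Real.rpow_mul hl0.le, show (-(1 / 2 : ℝ) + 3 / p) * s = -(1 / 2 : ℝ) by
      rw [hs_def]; field_simp; ring, Real.rpow_neg hl0.le] at h1
    rw [Real.rpow_neg hδ.le]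
    exact inv_le_of_inv_le₀ (by positivity) h1
  have hδhalf : lam ^ (1 / 2 : ℝ) ≤ lam * δ := by
    calc lam ^ (1 / 2 : ℝ) = lam * lam ^ (-(1 / 2 : ℝ)) := by
          nth_rewrite 2 [← Real.rpow_one lam]
          rw [← Real.rpow_add hl0]
          norm_num
      _ ≤ lam * δ := by
          gcongr
          refine le_trans ?_ hlδ
          apply Real.rpow_le_rpow_of_exponent_le hl.le
          have : 0 < 3 / p := by positivity
          linarith
  have hδp : lam ^ (3 * (p - 2) / 4) ≤ lam ^ (p - 3) * δ ^ (p / 2) := by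
    have h1 : (lam ^ (-(1 / 2 : ℝ) + 3 / p)) ^ (p / 2) ≤ δ ^ (p / 2) := by gcongr
    rw [← Real.rpow_mul hl0.le, show (-(1 / 2 : ℝ) + 3 / p) * (p / 2) = (6 - p) / 4 by
      field_simp; ring] at h1
    calc lam ^ (3 * (p - 2) / 4) = lam ^ (p - 3) * lam ^ ((6 - p) / 4) := by
          rw [← Real.rpow_add hl0]
          congr 1
          ring
      _ ≤ _ := by gcongr
  have hcardS : (S.card : ℝ) ≤ 2 * C₁ * (lam ^ 2 * δ) := by
    have h1 := hcard lam δ hl hδ hδ1 S hS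
    have h2 : δ * δ ^ (-(1 + s)) = δ ^ (-s) := by
      nth_rewrite 1 [← Real.rpow_one δ]
      rw [← Real.rpow_add hδ]
      congr 1
      ring
    have h3 : C₁ * lam * δ ^ (-s) ≤ C₁ * lam * (lam * δ) := by
      gcongr
      exact hδs.trans hδhalf
    calc (S.card : ℝ) ≤ C₁ * (lam * δ) * (lam + δ ^ (-(1 + s))) := h1
      _ = C₁ * (lam ^ 2 * δ) + C₁ * lam * (δ * δ ^ (-(1 + s))) := by ring
      _ ≤ _ := by
        rw [h2]
        linarith
  set A := (B * (2 * C₁ * (lam ^ 2 * δ))) ^ (1 / 2 : ℝ) with hA_def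
  set T := (C₂ * B * lam ^ (3 / 2 : ℝ)) ^ (1 / 2 : ℝ) with hT_def
  have hT2 : T ^ 2 = C₂ * B * lam ^ (3 / 2 : ℝ) := by
    rw [hT_def, ← Real.rpow_natCast, ← Real.rpow_mul (by positivity)]
    norm_num
  have hA : ∀ x, ‖torusSum S a x‖ ≤ A := by
    intro x
    rw [hA_def, ← Real.sqrt_eq_rpow]
    apply Real.le_sqrt_of_sq_le
    refine (norm_torusSum_sq_le S a x).trans ?_
    gcongr
  have hlarge : ∀ t, 0 < t → T ≤ t → volume.real {x | t < ‖torusSum S a x‖} ≤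
      (C₂ * B * (lam * δ)) ^ 3 * t ^ (-6 : ℝ) := by
    intro t ht htT
    refine hlevel lam δ S a hl hδ hδ1 hS t ht ?_
    calc C₂ * B * (lam * δ ^ (-s)) ≤ C₂ * B * (lam * lam ^ (1 / 2 : ℝ)) := by gcongr
      _ = T ^ 2 := by
        rw [hT2]
        congr 1
        nth_rewrite 1 [← Real.rpow_one lam]
        rw [← Real.rpow_add hl0]
        norm_num
      _ ≤ t ^ 2 := by
        have : 0 ≤ T := by positivity
        gcongr
  have htail := lintegral_rpow_le_of_tail volume (continuous_torusSum S a).measurable.norm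
    (fun x => norm_nonneg _) (p := p) (T := T) (A := A) (B := B) hp (by positivity)
    (by positivity) hBpos.le (by positivity) (fun t ht => measureReal_level_le S a ht) hlarge hA
  refine htail.trans (ENNReal.ofReal_le_ofReal ?_)
  have hTp : B * T ^ (p - 2) = C₂ ^ ((p - 2) / 2) * (B ^ (p / 2) * lam ^ (3 * (p - 2) / 4)) := by
    have hBB : B ^ (p / 2) = B * B ^ ((p - 2) / 2) := by
      nth_rewrite 2 [← Real.rpow_one B]
      rw [← Real.rpow_add hBpos]
      congr 1
      ring
    rw [hT_def, ← Real.rpow_mul (by positivity), Real.mul_rpow (by positivity) (by positivity),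
      Real.mul_rpow hC₂.le hBpos.le, ← Real.rpow_mul hl0.le, hBB,
      show 1 / 2 * (p - 2) = (p - 2) / 2 by ring,
      show 3 / 2 * ((p - 2) / 2) = 3 * (p - 2) / 4 by ring]
    ring
  have hAp : (C₂ * B * (lam * δ)) ^ 3 * A ^ (p - 6) =
      C₂ ^ 3 * (2 * C₁) ^ ((p - 6) / 2) * (B ^ (p / 2) * (lam ^ (p - 3) * δ ^ (p / 2))) := by
    have hpow : ∀ x : ℝ, 0 < x → x ^ (p / 2) = x ^ 3 * x ^ ((p - 6) / 2) := by
      intro x hx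
      rw [← Real.rpow_natCast x 3, ← Real.rpow_add hx]
      congr 1
      push_cast
      ring
    have hlp : lam ^ (p - 3) = lam ^ 3 * (lam ^ 2) ^ ((p - 6) / 2) := by
      rw [← Real.rpow_natCast lam 3, ← Real.rpow_natCast lam 2, ← Real.rpow_mul hl0.le,
        ← Real.rpow_add hl0]
      congr 1
      push_cast
      ring
    rw [hA_def, ← Real.rpow_mul (by positivity), show 1 / 2 * (p - 6) = (p - 6) / 2 by ring,
      Real.mul_rpow hBpos.le (by positivity), Real.mul_rpow (by positivity) (by positivity),
      Real.mul_rpow (x := lam ^ 2) (by positivity) hδ.le, hpow B hBpos, hpow δ hδ, hlp]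
    ring
  calc p * (B * (T ^ (p - 2) / (p - 2)) +
        (C₂ * B * (lam * δ)) ^ 3 * (A ^ (p - 6) / (p - 6)))
      = p * (C₂ ^ ((p - 2) / 2) / (p - 2) * (B ^ (p / 2) * lam ^ (3 * (p - 2) / 4)) +
          C₂ ^ 3 * (2 * C₁) ^ ((p - 6) / 2) / (p - 6) *
            (B ^ (p / 2) * (lam ^ (p - 3) * δ ^ (p / 2)))) := by
        rw [← mul_div_assoc, ← mul_div_assoc, hTp, hAp]
        ring
    _ ≤ p * (C₂ ^ ((p - 2) / 2) / (p - 2) * (B ^ (p / 2) * (lam ^ (p - 3) * δ ^ (p / 2))) +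
          C₂ ^ 3 * (2 * C₁) ^ ((p - 6) / 2) / (p - 6) *
            (B ^ (p / 2) * (lam ^ (p - 3) * δ ^ (p / 2)))) := by
        gcongr
    _ = _ := by ring

lemma trigSum_eq_torusSum (a : (Fin 3 → ℤ) →₀ ℂ) (x : Fin 3 → ℝ) :
    trigSum a x = torusSum a.support a (toTorus x) := by
  simp only [trigSum, torusSum, mFourier_toTorus]

lemma lpNorm_eq_lintegral_torusSum (p : ℝ) (a : (Fin 3 → ℤ) →₀ ℂ) :
    lpNorm p a =
      (∫⁻ x, ENNReal.ofReal (‖torusSum a.support a x‖ ^ p)).toReal ^ (1 / p) := by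
  have hset : (Set.univ.pi fun _ : Fin 3 => Set.Icc (0 : ℝ) 1) =ᵐ[volume]
      {x : Fin 3 → ℝ | ∀ i, x i ∈ Set.Ioc ((0 : Fin 3 → ℝ) i) ((0 : Fin 3 → ℝ) i + 1)} := by
    have h := (Measure.univ_pi_Ioc_ae_eq_Icc (μ := fun _ : Fin 3 => (volume : Measure ℝ))
      (f := 0) (g := 1)).symm
    rw [← Set.pi_univ_Icc] at h
    have h' : {x : Fin 3 → ℝ | ∀ i, x i ∈ Set.Ioc ((0 : Fin 3 → ℝ) i) ((0 : Fin 3 → ℝ) i + 1)} =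
        Set.univ.pi fun i => Set.Ioc ((0 : Fin 3 → ℝ) i) ((1 : Fin 3 → ℝ) i) := by
      ext x
      simp
    rw [h']
    exact h
  have hmeas : Measurable fun x => ‖torusSum a.support a x‖ ^ p :=
    (continuous_torusSum a.support a).measurable.norm.pow_const p
  have h := UnitAddTorus.integral_preimage (fun x => ‖torusSum a.support a x‖ ^ p)
    (0 : Fin 3 → ℝ)
  rw [_root_.lpNorm, setIntegral_congr_set hset]
  simp_rw [trigSum_eq_torusSum]
  rw [← integral_eq_lintegral_of_nonneg_ae
    (Filter.Eventually.of_forall fun x => by positivity) hmeas.aestronglyMeasurable, h]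
  rfl

end TorusKernel

theorem statement4 (p κ : ℝ) (hp2 : 2 ≤ p) (hκ : 0 < κ) :
    ∃ C : ℝ, 0 < C ∧
      ∀ lam δ : ℝ, 1 < lam → 0 < δ → δ < 1 →
        lam ^ (-(1 / 2 : ℝ) + 3 / p + κ) < δ →
        ∀ a : (Fin 3 → ℤ) →₀ ℂ,
          (∀ k ∈ a.support, |Real.sqrt (∑ i, ((k i : ℝ)) ^ 2) - lam| < δ) →
          lpNorm p a ≤
            C * ((lam * δ) ^ (1 / 2 - 1 / p) + lam ^ (1 - 3 / p) * δ ^ ((1:ℝ) / 2)) * l2Norm a := by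
  have hp0 : 0 < p := by linarith
  rcases le_or_gt p 6 with hp | hp
  · refine ⟨1, one_pos, fun lam δ hl _ hδ1 h => ?_⟩
    have h3 : (1 / 2 : ℝ) ≤ 3 / p := by
      rw [div_le_div_iff₀ two_pos hp0]
      linarith
    have := Real.one_le_rpow (x := lam) (z := -(1 / 2 : ℝ) + 3 / p + κ) hl.le (by linarith)
    linarith
  obtain ⟨C, hC, hmain⟩ := exists_lintegral_torusSum_rpow_le hp
  refine ⟨C ^ (1 / p), by positivity, fun lam δ hl hδ hδ1 hlδ a ha => ?_⟩
  have hl0 : 0 < lam := by linarith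
  have hB0 : 0 ≤ ∑ k ∈ a.support, ‖a k‖ ^ 2 := by positivity
  rcases hB0.eq_or_lt with hB | hB
  · have ha0 : a.support = ∅ := by
      by_contra hne
      obtain ⟨k, hk⟩ := Finset.nonempty_iff_ne_empty.2 hne
      have := (Finset.sum_eq_zero_iff_of_nonneg fun k _ => by positivity).1 hB.symm k hk
      exact Finsupp.mem_support_iff.1 hk (by simpa using this)
    simp [_root_.lpNorm, l2Norm, trigSum, ha0, hp0.ne']
  have hlδ' : lam ^ (-(1 / 2 : ℝ) + 3 / p) ≤ δ :=
    (Real.rpow_le_rpow_of_exponent_le hl.le (by linarith)).trans hlδ.le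
  have h := ENNReal.toReal_mono ENNReal.ofReal_ne_top
    (hmain lam δ a.support a hl hδ hδ1 hlδ' ha hB)
  rw [ENNReal.toReal_ofReal (by positivity)] at h
  rw [lpNorm_eq_lintegral_torusSum, l2Norm]
  set B := ∑ k ∈ a.support, ‖a k‖ ^ 2
  refine (Real.rpow_le_rpow ENNReal.toReal_nonneg h (by positivity)).trans ?_
  rw [Real.mul_rpow hC.le (by positivity), Real.mul_rpow (by positivity) (by positivity),
    Real.mul_rpow (x := lam ^ (p - 3)) (by positivity) (by positivity),
    ← Real.rpow_mul hB.le, ← Real.rpow_mul hl0.le, ← Real.rpow_mul hδ.le,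
    show p / 2 * (1 / p) = 1 / 2 by field_simp,
    show (p - 3) * (1 / p) = 1 - 3 / p by field_simp]
  have : 0 ≤ C ^ (1 / p) * (lam * δ) ^ (1 / 2 - 1 / p) * B ^ ((1 : ℝ) / 2) := by positivity
  linarith
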